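/- Let d ≥ 2 and let f and f' be binary strings of length d−1. If the generalized Fibonacci cubes Q_d(f) and Q_d(f') are isomorphic, then ν(f) = ν(f'). -/

import Mathlib

/-- Two binary strings differ in exactly one position. -/
def cubeRel (v w : List Bool) : Prop :=
  (List.zipWith (fun a b => a != b) v w).count true = 1

/-- The generalized Fibonacci cube `Q_d(f)`: the subgraph of the `d`-cube induced on
binary strings of length `d` not containing `f` as a consecutive substring. -/
def genFib (d : ℕ) (f : List Bool) :
    SimpleGraph {w : List Bool // w.length = d ∧ ¬ f <:+: w} :=
  SimpleGraph.fromRel fun v w => cubeRel v.1 w.1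

/-- Hamming distance between binary strings (of equal length). -/
def hDist (v w : List Bool) : ℕ :=
  (List.zipWith (fun a b => a != b) v w).count true

/-- One less than the number of blocks of `f`: the number of indices `i ≥ 2`
with `f_{i-1} ≠ f_i`. -/
def nu (f : List Bool) : ℕ :=
  (List.zipWith (fun a b => a != b) f f.tail).count true

namespace FibAux

/-- The cube on functions. -/
def cube (n : ℕ) : SimpleGraph (Fin n → Bool) where
  Adj x y := hammingDist x y = 1
  symm := ⟨fun x y h => by rw [hammingDist_comm]; exact h⟩
  loopless := ⟨fun x h => by simp at h⟩

/-- Walks with `k` steps. -/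
def wk {V : Type*} (G : SimpleGraph V) (k : ℕ) : Set (Fin (k + 1) → V) :=
  {p | ∀ i : Fin k, G.Adj (p i.castSucc) (p i.succ)}

/-- Walks with `k` steps in the cube avoiding `S`. -/
def av (n k : ℕ) (S : Set (Fin n → Bool)) : Set (Fin (k + 1) → (Fin n → Bool)) :=
  {p | p ∈ wk (cube n) k ∧ ∀ i, p i ∉ S}

/-- The edge in direction `i` through `x`. -/
def ed {n : ℕ} (x : Fin n → Bool) (i : Fin n) : Set (Fin n → Bool) :=
  {y | ∀ j, j ≠ i → y j = x j}

theorem wk_iso {V W : Type*} {G : SimpleGraph V} {H : SimpleGraph W} (e : G ≃g H) (k : ℕ) :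
    (wk G k).ncard = (wk H k).ncard := by
  have : wk H k = (fun p i => e (p i)) '' wk G k := by
    ext p
    constructor
    · intro hp
      refine ⟨fun i => e.symm (p i), fun i => ?_, by simp⟩
      exact e.symm.map_rel_iff.2 (hp i)
    · rintro ⟨q, hq, rfl⟩ i
      exact e.map_rel_iff.2 (hq i)
  rw [this, Set.ncard_image_of_injective]
  intro p q h
  funext i
  exact e.injective (congrFun h i)

theorem av_eq (n k : ℕ) (S : Set (Fin n → Bool)) :
    (av n k S).ncard = (wk ((cube n).induce Sᶜ) k).ncard := by
  have : av n k S = (fun p i => (p i : Fin n → Bool)) '' wk ((cube n).induce Sᶜ) k := by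
    ext p
    constructor
    · rintro ⟨hp, hS⟩
      exact ⟨fun i => ⟨p i, hS i⟩, fun i => hp i, rfl⟩
    · rintro ⟨q, hq, rfl⟩
      exact ⟨fun i => hq i, fun i => (q i).2⟩
  rw [this, Set.ncard_image_of_injective]
  intro p q h
  funext i
  exact Subtype.ext (congrFun h i)

/-- A cube automorphism. -/
def aut {n : ℕ} (x x' : Fin n → Bool) (i i' : Fin n) : cube n ≃g cube n where
  toFun y j := (y (Equiv.swap i i' j) ^^ x (Equiv.swap i i' j)) ^^ x' j
  invFun y j := (y (Equiv.swap i i' j) ^^ x' (Equiv.swap i i' j)) ^^ x j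
  left_inv y := by funext j; simp
  right_inv y := by funext j; simp
  map_rel_iff' := by
    intro a b
    simp only [cube, Equiv.coe_fn_mk, hammingDist]
    rw [Finset.card_equiv (Equiv.swap i i')]
    intro j
    simp

theorem aut_mem {n : ℕ} (x x' : Fin n → Bool) (i i' : Fin n) (y : Fin n → Bool) :
    aut x x' i i' y ∈ ed x' i' ↔ y ∈ ed x i := by
  simp only [ed, Set.mem_ofPred_eq]
  have e1 : ∀ j, aut x x' i i' y j = ((y (Equiv.swap i i' j) ^^ x (Equiv.swap i i' j)) ^^ x' j) :=
    fun j => rfl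
  constructor
  · intro h j hj
    have := h (Equiv.swap i i' j) (by
      intro h'
      apply hj
      have := congrArg (Equiv.swap i i') h'
      simpa using this)
    rw [e1] at this
    revert this
    rw [show Equiv.swap i i' (Equiv.swap i i' j) = j by simp]
    generalize y j = a
    generalize x j = b
    generalize x' (Equiv.swap i i' j) = c
    revert a b c
    decide
  · intro h j hj
    have := h (Equiv.swap i i' j) (by
      intro h'
      apply hj
      have := congrArg (Equiv.swap i i') h'
      simpa using this)
    rw [e1, this]
    simp

theorem av_ed (n k : ℕ) (x x' : Fin n → Bool) (i i' : Fin n) :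
    (av n k (ed x i)).ncard = (av n k (ed x' i')).ncard := by
  have : av n k (ed x' i') = (fun p j => aut x x' i i' (p j)) '' av n k (ed x i) := by
    ext p
    constructor
    · rintro ⟨hp, hS⟩
      refine ⟨fun j => (aut x x' i i').symm (p j), ⟨fun j => ?_, fun j => ?_⟩, by simp⟩
      · exact (aut x x' i i').symm.map_rel_iff.2 (hp j)
      · rw [← aut_mem x x' i i']
        simpa using hS j
    · rintro ⟨q, ⟨hq, hS⟩, rfl⟩
      refine ⟨fun j => (aut x x' i i').map_rel_iff.2 (hq j), fun j => ?_⟩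
      simp only [aut_mem]
      exact hS j
  rw [this, Set.ncard_image_of_injective]
  intro p q h
  funext j
  exact (aut x x' i i').injective (congrFun h j)

theorem dist_le {n k : ℕ} {p : Fin (k + 1) → Fin n → Bool} (hp : p ∈ wk (cube n) k) :
    ∀ (b a : ℕ) (ha : a ≤ b) (hb : b < k + 1),
      hammingDist (p ⟨a, by omega⟩) (p ⟨b, hb⟩) ≤ b - a := by
  intro b
  induction b with
  | zero =>
    intro a ha hb
    obtain rfl : a = 0 := by omega
    simp
  | succ b ih =>
    intro a ha hb
    rcases Nat.lt_or_ge b a with h | h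
    · obtain rfl : a = b + 1 := by omega
      simp
    · have h1 := ih a h (by omega)
      have h2 : hammingDist (p ⟨b, by omega⟩) (p ⟨b + 1, hb⟩) = 1 := hp ⟨b, by omega⟩
      have h3 := hammingDist_triangle (p ⟨a, by omega⟩) (p ⟨b, by omega⟩) (p ⟨b + 1, hb⟩)
      omega

theorem dist_le' {n k : ℕ} {p : Fin (k + 1) → Fin n → Bool} (hp : p ∈ wk (cube n) k)
    (a b : Fin (k + 1)) : hammingDist (p a) (p b) ≤ k := by
  rcases le_total a.1 b.1 with h | h
  · have := dist_le hp b.1 a.1 h b.2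
    simp only [Fin.eta] at this
    omega
  · have := dist_le hp a.1 b.1 h a.2
    simp only [Fin.eta] at this
    rw [hammingDist_comm]
    omega

theorem exists_walk {n : ℕ} : ∀ (k : ℕ) (x y : Fin n → Bool), hammingDist x y = k →
    ∃ p ∈ wk (cube n) k, p 0 = x ∧ p (Fin.last k) = y := by
  intro k
  induction k with
  | zero =>
    intro x y h
    have h := hammingDist_eq_zero.1 h
    exact ⟨fun _ => x, fun i => i.elim0, rfl, h⟩
  | succ k ih =>
    intro x y h
    have hne : x ≠ y := by rintro rfl; simp at h
    obtain ⟨i, hi⟩ := Function.ne_iff.1 hne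
    have e : (Finset.univ.filter fun j => x j ≠ y j)
        = insert i (Finset.univ.filter fun j => Function.update x i (y i) j ≠ y j) := by
      ext j
      by_cases hj : j = i
      · subst hj; simpa using hi
      · simp [hj]
    have h1 : hammingDist (Function.update x i (y i)) y = k := by
      unfold hammingDist at h ⊢
      rw [e, Finset.card_insert_of_notMem (by simp)] at h
      omega
    have h2 : hammingDist x (Function.update x i (y i)) = 1 := by
      unfold hammingDist
      rw [Finset.card_eq_one]
      refine ⟨i, ?_⟩
      ext j
      by_cases hj : j = i
      · subst hj; simpa using hi
      · simp [hj]
    obtain ⟨p, hp, h0, hl⟩ := ih _ _ h1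
    refine ⟨Fin.cons x p, fun j => ?_, rfl, ?_⟩
    · refine Fin.cases ?_ (fun j => ?_) j
      · simp only [Fin.castSucc_zero, Fin.cons_zero, Fin.cons_succ, h0]
        exact h2
      · have := hp j
        simpa [← Fin.succ_castSucc] using this
    · rw [← Fin.succ_last, Fin.cons_succ, hl]

theorem hDist_ofFn : ∀ {n : ℕ} (x y : Fin n → Bool),
    hDist (List.ofFn x) (List.ofFn y) = hammingDist x y := by
  intro n
  induction n with
  | zero => intro x y; simp [hDist, hammingDist]
  | succ n ih =>
    intro x y
    have := ih (fun i => x i.succ) (fun i => y i.succ)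
    simp only [hDist, hammingDist] at this ⊢
    rw [List.ofFn_succ, List.ofFn_succ, List.zipWith_cons_cons, List.count_cons, this,
      Fin.univ_succ, Finset.filter_cons]
    by_cases h : x 0 = y 0
    · simp [h, Finset.filter_map]
    · simp [h, Finset.filter_map]

theorem hDist_cons (a b : Bool) (v w : List Bool) :
    hDist (a :: v) (b :: w) = hDist v w + if a = b then 0 else 1 := by
  simp only [hDist, List.zipWith_cons_cons, List.count_cons]
  cases a <;> cases b <;> simp

theorem nu_cons (a b : Bool) (w : List Bool) :
    nu (a :: b :: w) = nu (b :: w) + if a = b then 0 else 1 := by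
  simp only [nu, List.tail_cons, List.zipWith_cons_cons, List.count_cons]
  cases a <;> cases b <;> simp

theorem nu_le (b : Bool) : ∀ (t : List Bool) (c : Bool),
    nu (c :: t) ≤ hDist (c :: t) (t ++ [b]) := by
  intro t
  induction t with
  | nil => intro c; simp [nu]
  | cons c' t ih =>
    intro c
    rw [nu_cons, List.cons_append, hDist_cons]
    have := ih c'
    omega

theorem nu_eq : ∀ (t : List Bool) (c : Bool),
    ∃ b, hDist (c :: t) (t ++ [b]) = nu (c :: t) := by
  intro t
  induction t with
  | nil => intro c; exact ⟨c, by simp [nu, hDist]⟩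
  | cons c' t ih =>
    intro c
    obtain ⟨b, hb⟩ := ih c'
    exact ⟨b, by rw [nu_cons, List.cons_append, hDist_cons, hb]⟩

theorem nu_le' (f : List Bool) (hf : f ≠ []) (a b : Bool) : nu f ≤ hDist (a :: f) (f ++ [b]) := by
  obtain ⟨c, t, rfl⟩ := List.exists_cons_of_ne_nil hf
  rw [List.cons_append, hDist_cons]
  have := nu_le b t c
  omega

theorem nu_eq' (f : List Bool) (hf : f ≠ []) : ∃ a b, hDist (a :: f) (f ++ [b]) = nu f := by
  obtain ⟨c, t, rfl⟩ := List.exists_cons_of_ne_nil hf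
  obtain ⟨b, hb⟩ := nu_eq t c
  exact ⟨c, b, by rw [List.cons_append, hDist_cons, hb]; simp⟩

/-- First removed edge. -/
def E1 {n : ℕ} (g : Fin n → Bool) : Set (Fin (n + 1) → Bool) :=
  ed (Fin.cons false g : Fin (n + 1) → Bool) 0

/-- Second removed edge. -/
def E2 {n : ℕ} (g : Fin n → Bool) : Set (Fin (n + 1) → Bool) :=
  ed (Fin.snoc g false : Fin (n + 1) → Bool) (Fin.last n)

theorem mem_E1 {n : ℕ} (g : Fin n → Bool) (x : Fin (n + 1) → Bool) :
    x ∈ E1 g ↔ ∃ a, List.ofFn x = a :: List.ofFn g := by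
  simp only [List.ofFn_succ, E1, ed, Set.mem_ofPred_eq, List.cons.injEq, exists_eq_left',
    List.ofFn_inj]
  constructor
  · intro h
    funext i
    simpa using h i.succ (Fin.succ_ne_zero i)
  · intro h j hj
    obtain ⟨i, rfl⟩ := Fin.exists_succ_eq.2 hj
    simpa using congrFun h i

theorem mem_E2 {n : ℕ} (g : Fin n → Bool) (x : Fin (n + 1) → Bool) :
    x ∈ E2 g ↔ ∃ b, List.ofFn x = List.ofFn g ++ [b] := by
  simp only [List.ofFn_succ', E2, ed, Set.mem_ofPred_eq, List.concat_eq_append]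
  constructor
  · intro h
    refine ⟨x (Fin.last n), ?_⟩
    congr 2
    funext i
    simpa using h i.castSucc (Fin.castSucc_lt_last i).ne
  · rintro ⟨b, h⟩ j hj
    have h := List.ofFn_injective (List.append_inj' h rfl).1
    obtain ⟨i, rfl⟩ := Fin.exists_castSucc_eq.2 hj
    simpa using congrFun h i

theorem infix_iff {n : ℕ} (g : Fin n → Bool) (x : Fin (n + 1) → Bool) :
    List.ofFn g <:+: List.ofFn x ↔ x ∈ E1 g ∪ E2 g := by
  rw [Set.mem_union, mem_E1, mem_E2]
  constructor
  · rintro ⟨s, t, h⟩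
    have hl := congrArg List.length h
    simp only [List.length_append, List.length_ofFn] at hl
    rcases s with _ | ⟨a, s⟩
    · right
      obtain ⟨b, rfl⟩ := List.length_eq_one_iff.1 (show t.length = 1 by simp at hl; omega)
      exact ⟨b, by rw [← h]; simp⟩
    · left
      simp only [List.length_cons] at hl
      obtain rfl := List.length_eq_zero_iff.1 (show t.length = 0 by omega)
      obtain rfl := List.length_eq_zero_iff.1 (show s.length = 0 by omega)
      exact ⟨a, by rw [← h]; simp⟩
  · rintro (⟨a, h⟩ | ⟨b, h⟩)
    · exact ⟨[a], [], by rw [h]; simp⟩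
    · exact ⟨[], [b], by rw [h]; simp⟩

theorem adj_iff {d : ℕ} {f : List Bool} (v w : {w : List Bool // w.length = d ∧ ¬ f <:+: w}) 
    (x y : Fin d → Bool) (hx : v.1 = List.ofFn x) (hy : w.1 = List.ofFn y) :
    (genFib d f).Adj v w ↔ (cube d).Adj x y := by
  have c : ∀ x y : Fin d → Bool, cubeRel (List.ofFn x) (List.ofFn y) ↔ hammingDist x y = 1 := by
    intro x y
    rw [← hDist_ofFn]; rfl
  simp only [genFib, SimpleGraph.fromRel_adj, hx, hy, c, cube]
  rw [hammingDist_comm y x, or_self, and_iff_right_iff_imp]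
  rintro h rfl
  rw [hx] at hy
  obtain rfl := List.ofFn_injective hy
  simp at h

/-- The isomorphism with the function model. -/
def model {n : ℕ} (g : Fin n → Bool) :
    (cube (n + 1)).induce (E1 g ∪ E2 g)ᶜ ≃g genFib (n + 1) (List.ofFn g) where
  toFun x := ⟨List.ofFn x.1, by simp, fun h => x.2 ((infix_iff g x.1).1 h)⟩
  invFun w := ⟨fun i => w.1.get (i.cast w.2.1.symm), fun h => w.2.2 (by
    rw [← infix_iff] at h
    have e : List.ofFn (fun i : Fin (n + 1) => w.1.get (i.cast w.2.1.symm)) = w.1 := by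
      apply List.ext_get
      · simp [w.2.1]
      · intro i h1 h2; simp [-List.ofFn_succ]
    rwa [e] at h)⟩
  left_inv x := by
    apply Subtype.ext
    funext i
    simp [-List.ofFn_succ]
  right_inv w := by
    apply Subtype.ext
    apply List.ext_get
    · simp [w.2.1]
    · intro i h1 h2; simp [-List.ofFn_succ]
  map_rel_iff' := by
    intro a b
    exact adj_iff _ _ a.1 b.1 rfl rfl

theorem av_union (n k : ℕ) (S T : Set (Fin n → Bool)) :
    av n k (S ∪ T) = av n k S ∩ av n k T := by
  ext p
  simp only [av, Set.mem_ofPred_eq, Set.mem_inter_iff, Set.mem_union, not_or, forall_and]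
  tauto

theorem key {n : ℕ} (hn : 1 ≤ n) (g g' : Fin n → Bool)
    (h : Nonempty (genFib (n + 1) (List.ofFn g) ≃g genFib (n + 1) (List.ofFn g'))) :
    ¬ nu (List.ofFn g) < nu (List.ofFn g') := by
  intro hlt
  obtain ⟨φ⟩ := h
  have hne : ∀ g : Fin n → Bool, List.ofFn g ≠ [] := by
    intro g h
    have := congrArg List.length h
    simp at this
    omega
  obtain ⟨k, hk⟩ : ∃ k, k = nu (List.ofFn g) := ⟨_, rfl⟩
  have e := wk_iso (((model g).trans φ).trans (model g').symm) k
  rw [← av_eq, ← av_eq, av_union, av_union] at e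
  have u1 := Set.ncard_union_add_ncard_inter (av (n + 1) k (E1 g)) (av (n + 1) k (E2 g))
    (Set.toFinite _) (Set.toFinite _)
  have u2 := Set.ncard_union_add_ncard_inter (av (n + 1) k (E1 g')) (av (n + 1) k (E2 g'))
    (Set.toFinite _) (Set.toFinite _)
  have c1 : (av (n + 1) k (E1 g)).ncard = (av (n + 1) k (E1 g')).ncard := av_ed _ _ _ _ _ _
  have c2 : (av (n + 1) k (E2 g)).ncard = (av (n + 1) k (E2 g')).ncard := av_ed _ _ _ _ _ _
  have full : av (n + 1) k (E1 g') ∪ av (n + 1) k (E2 g') = wk (cube (n + 1)) k := by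
    apply Set.Subset.antisymm
    · rintro p (hp | hp) <;> exact hp.1
    · intro p hp
      by_contra hcon
      simp only [av, Set.mem_union, Set.mem_ofPred_eq, hp, true_and, not_or, not_forall,
        not_not] at hcon
      obtain ⟨⟨i, hi⟩, j, hj⟩ := hcon
      obtain ⟨a, ha⟩ := (mem_E1 _ _).1 hi
      obtain ⟨b, hb⟩ := (mem_E2 _ _).1 hj
      have h1 := nu_le' (List.ofFn g') (hne g') a b
      rw [← ha, ← hb, hDist_ofFn] at h1
      have := dist_le' hp i j
      omega
  have part : av (n + 1) k (E1 g) ∪ av (n + 1) k (E2 g) ⊂ wk (cube (n + 1)) k := by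
    refine ⟨?_, fun hsub => ?_⟩
    · rintro p (hp | hp) <;> exact hp.1
    · obtain ⟨a, b, hab⟩ := nu_eq' (List.ofFn g) (hne g)
      have ea : List.ofFn (Fin.cons a g : Fin (n + 1) → Bool) = a :: List.ofFn g := by
        simp [List.ofFn_succ]
      have eb : List.ofFn (Fin.snoc g b : Fin (n + 1) → Bool) = List.ofFn g ++ [b] := by
        rw [List.ofFn_succ']
        simp
      rw [← ea, ← eb, hDist_ofFn, ← hk] at hab
      obtain ⟨p, hp, h0, hl⟩ := exists_walk k _ _ hab
      rcases hsub hp with hq | hq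
      · exact hq.2 0 (by rw [h0, mem_E1]; exact ⟨a, ea⟩)
      · exact hq.2 (Fin.last k) (by rw [hl, mem_E2]; exact ⟨b, eb⟩)
  have lt := Set.ncard_lt_ncard part (Set.toFinite _)
  rw [full] at u2
  omega

end FibAux

theorem stmt4 (d : ℕ) (hd : 2 ≤ d) (f f' : List Bool)
    (hf : f.length = d - 1) (hf' : f'.length = d - 1)
    (h : Nonempty (genFib d f ≃g genFib d f')) :
    nu f = nu f' := by
  obtain ⟨n, rfl⟩ : ∃ n, d = n + 1 := ⟨d - 1, by omega⟩
  simp only [Nat.add_sub_cancel] at hf hf'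
  have ex : ∀ l : List Bool, l.length = n → ∃ g : Fin n → Bool, l = List.ofFn g := by
    rintro l rfl
    exact ⟨l.get, (List.ofFn_get l).symm⟩
  obtain ⟨g, rfl⟩ := ex f hf
  obtain ⟨g', rfl⟩ := ex f' hf'
  have h1 := FibAux.key (by omega) g g' h
  have h2 := FibAux.key (by omega) g' g (h.map fun e => e.symm)
  omega
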